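/- Let {P_n^{(1)}}_{n≥0} and {P_n^{(q^{1/2})}}_{n≥0} be families of monic orthogonal polynomials on the lattices ±q^ℤ and ±q^{1/2} q^ℤ respectively, with weight w and norms γ_n^{(1)}, γ_n^{(q^{1/2})}. Then P_n^{(1)} = P_n^{(q^{1/2})} for every n, and γ_1^{(1)} / γ_1^{(q^{1/2})} = q^{1/2} h_q(e^{iπ/4}) / h_q(q^{1/2} e^{iπ/4}). -/

import Mathlib

open Polynomial Topology

/-- The function `h_q(z) = ∑_{k=-∞}^{∞} 2 z q^k / (z² - q^{2k})`. -/
noncomputable def hqfun (q : ℝ) (z : ℂ) : ℂ :=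
  ∑' k : ℤ, 2 * z * (q : ℂ) ^ k / (z ^ 2 - (q : ℂ) ^ (2 * k))

/-- The weight `w(x) = ∏_{j=0}^∞ (1 + x⁴ q^{4j})⁻¹`. -/
noncomputable def qweight (q x : ℝ) : ℝ := ∏' j : ℕ, (1 + x ^ 4 * q ^ (4 * j))⁻¹

/-- A family of monic orthogonal polynomials on the lattice `±c qᶻ` with weight `qweight q`. -/
structure MonicOrthFamily (q c : ℝ) where
  P : ℕ → Polynomial ℝ
  γ : ℕ → ℝ
  monic : ∀ n, (P n).Monic
  deg : ∀ n, (P n).natDegree = n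
  γ_pos : ∀ n, 0 < γ n
  abs_summable : ∀ n m : ℕ, Summable (fun k : ℤ =>
    |((P n).eval (c * q ^ k) * (P m).eval (c * q ^ k) * qweight q (c * q ^ k)
      + (P n).eval (-(c * q ^ k)) * (P m).eval (-(c * q ^ k)) * qweight q (-(c * q ^ k)))
        * q ^ k|)
  orth : ∀ n m : ℕ,
    (∑' k : ℤ, ((P n).eval (c * q ^ k) * (P m).eval (c * q ^ k) * qweight q (c * q ^ k)
      + (P n).eval (-(c * q ^ k)) * (P m).eval (-(c * q ^ k)) * qweight q (-(c * q ^ k)))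
        * q ^ k)
      = if n = m then γ n else 0

open Filter

lemma HasSum.of_eq {f g : ℤ → ℝ} {u v : ℝ} (h : HasSum f u) (hfg : ∀ k, g k = f k)
    (huv : v = u) : HasSum g v := by
  rwa [huv, funext hfg]

section LatticeSums

variable {q : ℝ}

/-- The truncated weight `∏_{j<N} (1 + x⁴ q^{4j})⁻¹`. -/
noncomputable def truncWeight (q : ℝ) (N : ℕ) (x : ℝ) : ℝ :=
  ∏ j ∈ Finset.range N, (1 + x ^ 4 * q ^ (4 * j))⁻¹

/-- The sum of `x ^ a / (1 + x⁴)` over the lattice `c qᶻ`. -/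
noncomputable def kernelSum (q : ℝ) (a : ℕ) (c : ℝ) : ℝ :=
  ∑' k : ℤ, (c * q ^ k) ^ a / (1 + (c * q ^ k) ^ 4)

lemma truncWeight_succ (N : ℕ) (x : ℝ) :
    truncWeight q (N + 1) x = truncWeight q N x * (1 + x ^ 4 * q ^ (4 * N))⁻¹ := by
  rw [truncWeight, truncWeight, Finset.prod_range_succ]

lemma truncWeight_succ' (N : ℕ) (x : ℝ) :
    truncWeight q (N + 1) x = truncWeight q N (q * x) * (1 + x ^ 4)⁻¹ := by
  simp only [truncWeight, Finset.prod_range_succ']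
  congr 1
  · refine Finset.prod_congr rfl fun j _ => ?_
    congr 1
    ring
  · simp

lemma truncWeight_nonneg (hq : 0 < q) (N : ℕ) (x : ℝ) : 0 ≤ truncWeight q N x :=
  Finset.prod_nonneg fun j _ => by positivity

lemma truncWeight_le_one (hq : 0 < q) (N : ℕ) (x : ℝ) : truncWeight q N x ≤ 1 := by
  refine Finset.prod_le_one (fun j _ => by positivity) fun j _ => ?_
  have : 0 ≤ x ^ 4 * q ^ (4 * j) := by positivity
  exact inv_le_one_of_one_le₀ (by linarith)

lemma truncWeight_succ_le (hq : 0 < q) (N : ℕ) (x : ℝ) :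
    truncWeight q (N + 1) x ≤ (1 + x ^ 4)⁻¹ := by
  rw [truncWeight_succ']
  exact mul_le_of_le_one_left (by positivity) (truncWeight_le_one hq N _)

lemma truncWeight_contiguous (hq : 0 < q) (N : ℕ) (x : ℝ) :
    (1 - q ^ (4 * N)) * truncWeight q (N + 1) x
      = truncWeight q N x - q ^ (4 * N) * truncWeight q N (q * x) := by
  have h1 : truncWeight q N x = truncWeight q (N + 1) x * (1 + x ^ 4 * q ^ (4 * N)) := by
    rw [truncWeight_succ, inv_mul_cancel_right₀ (by positivity)]
  have h2 : truncWeight q N (q * x) = truncWeight q (N + 1) x * (1 + x ^ 4) := by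
    rw [truncWeight_succ', inv_mul_cancel_right₀ (by positivity)]
  rw [h1, h2]
  ring

lemma tendsto_truncWeight (hq0 : 0 < q) (hq1 : q < 1) (x : ℝ) :
    Tendsto (fun N => truncWeight q N x) atTop (𝓝 (qweight q x)) := by
  have hs : Summable fun j : ℕ => x ^ 4 * q ^ (4 * j) := by
    simp_rw [pow_mul]
    exact (summable_geometric_of_lt_one (by positivity)
      (pow_lt_one₀ hq0.le hq1 (by norm_num))).mul_left _
  have hp : HasProd (fun j : ℕ => 1 + x ^ 4 * q ^ (4 * j))
      (∏' j : ℕ, (1 + x ^ 4 * q ^ (4 * j))) :=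
    (Real.multipliable_one_add_of_summable hs).hasProd
  have hge : 1 ≤ ∏' j : ℕ, (1 + x ^ 4 * q ^ (4 * j)) := by
    refine ge_of_tendsto' hp.tendsto_prod_nat fun N => ?_
    exact Finset.one_le_prod fun j _ => le_add_of_nonneg_right (by positivity)
  exact (hp.inv₀ (by linarith)).multipliable.hasProd.tendsto_prod_nat

lemma qweight_neg (x : ℝ) : qweight q (-x) = qweight q x := by
  simp [qweight, Even.neg_pow (by decide : Even 4)]

lemma qweight_mul (hq0 : 0 < q) (hq1 : q < 1) (x : ℝ) :
    qweight q (q * x) = (1 + x ^ 4) * qweight q x := by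
  refine tendsto_nhds_unique (tendsto_truncWeight hq0 hq1 (q * x)) ?_
  have h := ((tendsto_add_atTop_iff_nat 1).2 (tendsto_truncWeight hq0 hq1 x)).const_mul (1 + x ^ 4)
  refine h.congr fun N => ?_
  rw [truncWeight_succ']
  field_simp

lemma HasSum.lattice_mul_left (hq : q ≠ 0) {f : ℝ → ℝ} {c v : ℝ}
    (h : HasSum (fun k : ℤ => f (c * q ^ k)) v) :
    HasSum (fun k : ℤ => f (q * (c * q ^ k))) v := by
  refine ((Equiv.addRight (1 : ℤ)).hasSum_iff.2 h).of_eq (fun k => ?_) rfl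
  simp only [Function.comp_apply, Equiv.coe_addRight, zpow_add_one₀ hq]
  ring_nf

lemma summable_kernel (hq0 : 0 < q) (hq1 : q < 1) {a : ℕ} (ha : 1 ≤ a) (ha' : a ≤ 3)
    {c : ℝ} (hc : 0 < c) :
    Summable fun k : ℤ => (c * q ^ k) ^ a / (1 + (c * q ^ k) ^ 4) := by
  have key : ∀ x : ℝ, 0 < x → x ^ a / (1 + x ^ 4) ≤ x ∧ x ^ a / (1 + x ^ 4) ≤ x⁻¹ := by
    intro x hx
    rw [div_le_iff₀ (by positivity), div_le_iff₀ (by positivity), inv_mul_eq_div, le_div_iff₀ hx]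
    interval_cases a
    · constructor <;> nlinarith [sq_nonneg (x ^ 2 - 1), pow_pos hx 5]
    · constructor
      · nlinarith [mul_nonneg hx.le (sq_nonneg (x ^ 2 - x)), mul_nonneg hx.le (sq_nonneg (x - 1)),
          mul_nonneg hx.le (sq_nonneg (x ^ 2 - 1)), mul_nonneg hx.le (sq_nonneg (x ^ 2))]
      · nlinarith [sq_nonneg (x ^ 2 - x), sq_nonneg (x - 1), sq_nonneg (x ^ 2 - 1), sq_nonneg x]
    · constructor
      · nlinarith [mul_nonneg hx.le (sq_nonneg (x ^ 2 - 1)), pow_pos hx 3]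
      · nlinarith
  have hgeo : Summable fun n : ℕ => q ^ n := summable_geometric_of_lt_one hq0.le hq1
  refine Summable.of_nat_of_neg ?_ ?_
  · refine Summable.of_nonneg_of_le (fun n => by positivity)
      (fun n => (key (c * q ^ (n : ℤ)) (by positivity)).1) ?_
    simpa using hgeo.mul_left c
  · refine Summable.of_nonneg_of_le (fun n => by positivity)
      (fun n => (key (c * q ^ (-(n : ℤ))) (by positivity)).2) ?_
    simpa [mul_comm] using hgeo.mul_left c⁻¹

lemma kernelSum_pos (hq0 : 0 < q) (hq1 : q < 1) {a : ℕ} (ha : 1 ≤ a) (ha' : a ≤ 3)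
    {c : ℝ} (hc : 0 < c) : 0 < kernelSum q a c :=
  (summable_kernel hq0 hq1 ha ha' hc).tsum_pos (fun k => by positivity) 0 (by positivity)

lemma kernelSum_three_inv (hq : 0 < q) {c : ℝ} (hc : 0 < c) :
    kernelSum q 3 c⁻¹ = kernelSum q 1 c := by
  unfold kernelSum
  rw [← (Equiv.neg ℤ).tsum_eq]
  refine tsum_congr fun k => ?_
  have : 0 < q ^ k := by positivity
  simp only [Equiv.neg_apply, zpow_neg]
  field_simp
  ring

lemma kernelSum_one_inv (hq : 0 < q) {c : ℝ} (hc : 0 < c) :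
    kernelSum q 1 c⁻¹ = kernelSum q 3 c := by
  rw [← kernelSum_three_inv hq (inv_pos.2 hc), inv_inv]

lemma kernelSum_mul_left (hq : q ≠ 0) (a : ℕ) (c : ℝ) :
    kernelSum q a (q * c) = kernelSum q a c := by
  unfold kernelSum
  rw [← (Equiv.addRight (1 : ℤ)).tsum_eq (fun k : ℤ => (c * q ^ k) ^ a / (1 + (c * q ^ k) ^ 4))]
  refine tsum_congr fun k => ?_
  have : q * c * q ^ k = c * q ^ (k + 1) := by rw [zpow_add_one₀ hq]; ring
  simp [this]

lemma kernelSum_three_one (hq : 0 < q) : kernelSum q 3 1 = kernelSum q 1 1 := by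
  simpa using kernelSum_three_inv hq one_pos

lemma kernelSum_three_sqrt (hq : 0 < q) :
    kernelSum q 3 (√q) = kernelSum q 1 (√q) := by
  have hs : 0 < √q := Real.sqrt_pos.2 hq
  rw [← kernelSum_three_inv hq hs, ← kernelSum_mul_left hq.ne' 3 (√q)⁻¹]
  congr 1
  rw [eq_mul_inv_iff_mul_eq₀ hs.ne', Real.mul_self_sqrt hq.le]

lemma exists_hasSum_truncWeight (hq0 : 0 < q) (hq1 : q < 1) {a : ℕ} (ha : 1 ≤ a) (ha' : a ≤ 3)
    (N : ℕ) : ∃ K : ℝ, ∀ c : ℝ, 0 < c →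
      HasSum (fun k : ℤ => (c * q ^ k) ^ a * truncWeight q (N + 1) (c * q ^ k))
        (K * kernelSum q a c) := by
  induction N with
  | zero =>
    refine ⟨1, fun c hc => ?_⟩
    simpa [truncWeight, div_eq_mul_inv, kernelSum] using (summable_kernel hq0 hq1 ha ha' hc).hasSum
  | succ N ih =>
    obtain ⟨K, hK⟩ := ih
    have hp : (1 : ℝ) - q ^ (4 * (N + 1)) ≠ 0 :=
      (sub_pos.2 (pow_lt_one₀ hq0.le hq1 (by omega))).ne'
    refine ⟨(K - q ^ (4 * (N + 1)) * (q ^ a)⁻¹ * K) / (1 - q ^ (4 * (N + 1))), fun c hc => ?_⟩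
    have h1 := hK c hc
    have h2 := HasSum.lattice_mul_left hq0.ne' (f := fun x => x ^ a * truncWeight q (N + 1) x) h1
    have h3 := (h1.sub (h2.mul_left (q ^ (4 * (N + 1)) * (q ^ a)⁻¹))).div_const
      (1 - q ^ (4 * (N + 1)))
    refine HasSum.of_eq h3 (fun k => ?_) ?_
    · rw [eq_div_iff hp]
      have := truncWeight_contiguous hq0 (N + 1) (c * q ^ k)
      rw [mul_assoc, mul_comm (truncWeight _ _ _), this, mul_pow q]
      have : q ^ a ≠ 0 := by positivity
      field_simp
    · ring

lemma exists_hasSum_qweight_base (hq0 : 0 < q) (hq1 : q < 1) {a : ℕ} (ha : 1 ≤ a) (ha' : a ≤ 3) :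
    ∃ K : ℝ, ∀ c : ℝ, 0 < c →
      HasSum (fun k : ℤ => (c * q ^ k) ^ a * qweight q (c * q ^ k)) (K * kernelSum q a c) := by
  choose K hK using exists_hasSum_truncWeight hq0 hq1 ha ha'
  have hbound : ∀ c : ℝ, 0 < c → ∀ N (k : ℤ),
      ‖(c * q ^ k) ^ a * truncWeight q (N + 1) (c * q ^ k)‖
        ≤ (c * q ^ k) ^ a / (1 + (c * q ^ k) ^ 4) := by
    intro c hc N k
    have h0 := truncWeight_nonneg hq0 (N + 1) (c * q ^ k)
    rw [Real.norm_of_nonneg (by positivity), div_eq_mul_inv]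
    exact mul_le_mul_of_nonneg_left (truncWeight_succ_le hq0 N _) (by positivity)
  have hpt : ∀ c : ℝ, ∀ k : ℤ,
      Tendsto (fun N => (c * q ^ k) ^ a * truncWeight q (N + 1) (c * q ^ k)) atTop
        (𝓝 ((c * q ^ k) ^ a * qweight q (c * q ^ k))) := fun c k =>
    ((tendsto_add_atTop_iff_nat 1).2 (tendsto_truncWeight hq0 hq1 _)).const_mul _
  have hsum : ∀ c : ℝ, 0 < c →
      Summable (fun k : ℤ => (c * q ^ k) ^ a * qweight q (c * q ^ k)) := fun c hc =>
    (summable_kernel hq0 hq1 ha ha' hc).of_norm_bounded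
      fun k => le_of_tendsto' (hpt c k).norm fun N => hbound c hc N k
  have hlim : ∀ c : ℝ, 0 < c → Tendsto K atTop
      (𝓝 ((∑' k : ℤ, (c * q ^ k) ^ a * qweight q (c * q ^ k)) / kernelSum q a c)) := by
    intro c hc
    have hS := (kernelSum_pos hq0 hq1 ha ha' hc).ne'
    have h := tendsto_tsum_of_dominated_convergence (summable_kernel hq0 hq1 ha ha' hc)
      (hpt c) (Eventually.of_forall (hbound c hc))
    refine (h.div_const (kernelSum q a c)).congr fun N => ?_
    rw [(hK N c hc).tsum_eq, mul_div_cancel_right₀ _ hS]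
  refine ⟨(∑' k : ℤ, (1 * q ^ k) ^ a * qweight q (1 * q ^ k)) / kernelSum q a 1, fun c hc => ?_⟩
  rw [tendsto_nhds_unique (hlim 1 one_pos) (hlim c hc),
    div_mul_cancel₀ _ (kernelSum_pos hq0 hq1 ha ha' hc).ne']
  exact (hsum c hc).hasSum

lemma HasSum.qweight_add_four (hq0 : 0 < q) (hq1 : q < 1) {a : ℕ} {c v : ℝ}
    (h : HasSum (fun k : ℤ => (c * q ^ k) ^ a * qweight q (c * q ^ k)) v) :
    HasSum (fun k : ℤ => (c * q ^ k) ^ (a + 4) * qweight q (c * q ^ k))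
      (((q ^ a)⁻¹ - 1) * v) := by
  have h2 := HasSum.lattice_mul_left hq0.ne' (f := fun x => x ^ a * qweight q x) h
  refine HasSum.of_eq ((h2.mul_left (q ^ a)⁻¹).sub h) (fun k => ?_) ?_
  · have : q ^ a ≠ 0 := by positivity
    rw [qweight_mul hq0 hq1, mul_pow q]
    field_simp
    ring
  · ring

lemma exists_hasSum_qweight_odd (hq0 : 0 < q) (hq1 : q < 1) (n : ℕ) :
    ∃ K : ℝ, ∀ c : ℝ, 0 < c → kernelSum q 3 c = kernelSum q 1 c →
      HasSum (fun k : ℤ => (c * q ^ k) ^ (2 * n + 1) * qweight q (c * q ^ k))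
        (K * kernelSum q 1 c) := by
  induction n using Nat.twoStepInduction with
  | zero =>
    obtain ⟨K, hK⟩ := exists_hasSum_qweight_base hq0 hq1 (a := 1) le_rfl (by norm_num)
    exact ⟨K, fun c hc _ => hK c hc⟩
  | one =>
    obtain ⟨K, hK⟩ := exists_hasSum_qweight_base hq0 hq1 (a := 3) (by norm_num) le_rfl
    exact ⟨K, fun c hc h => h ▸ hK c hc⟩
  | more n ih _ =>
    obtain ⟨K, hK⟩ := ih
    refine ⟨((q ^ (2 * n + 1))⁻¹ - 1) * K, fun c hc h => ?_⟩
    rw [mul_assoc]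
    exact (hK c hc h).qweight_add_four hq0 hq1

/-- The summand of the functional attached to the lattice `±c qᶻ`. -/
noncomputable def latticeTerm (q c : ℝ) (p : ℝ[X]) (k : ℤ) : ℝ :=
  (p.eval (c * q ^ k) * qweight q (c * q ^ k)
    + p.eval (-(c * q ^ k)) * qweight q (-(c * q ^ k))) * q ^ k

lemma exists_hasSum_latticeTerm (hq0 : 0 < q) (hq1 : q < 1) (p : ℝ[X]) :
    ∃ K : ℝ, ∀ c : ℝ, 0 < c → kernelSum q 3 c = kernelSum q 1 c →
      HasSum (latticeTerm q c p) (K * (kernelSum q 1 c / c)) := by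
  induction p using Polynomial.induction_on' with
  | add p r hp hr =>
    obtain ⟨K, hK⟩ := hp
    obtain ⟨J, hJ⟩ := hr
    refine ⟨K + J, fun c hc h => ((hK c hc h).add (hJ c hc h)).of_eq (fun k => ?_) ?_⟩
    · simp only [latticeTerm, eval_add]
      ring
    · ring
  | monomial n b =>
    rcases Nat.even_or_odd' n with ⟨m, rfl | rfl⟩
    · obtain ⟨K, hK⟩ := exists_hasSum_qweight_odd hq0 hq1 m
      refine ⟨2 * b * K, fun c hc h => ?_⟩
      refine HasSum.of_eq ((hK c hc h).mul_left (2 * b / c)) (fun k => ?_) ?_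
      · simp only [latticeTerm, eval_monomial, qweight_neg, (even_two_mul m).neg_pow]
        field_simp
        ring
      · field_simp
    · refine ⟨0, fun c hc h => ?_⟩
      have hodd : Odd (2 * m + 1) := ⟨m, rfl⟩
      refine HasSum.of_eq hasSum_zero (fun k => ?_) ?_
      · simp only [latticeTerm, eval_monomial, qweight_neg, hodd.neg_pow]
        ring
      · ring

/-- The functional `p ↦ ∑ p(x) w(x) |x|` over the lattice `±c qᶻ`, as a linear map. -/
noncomputable def latticeFunctional (q c : ℝ) (h : ∀ p, Summable (latticeTerm q c p)) :
    ℝ[X] →ₗ[ℝ] ℝ where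
  toFun p := ∑' k, latticeTerm q c p k
  map_add' p r := by
    rw [← (h p).tsum_add (h r)]
    refine tsum_congr fun k => ?_
    simp only [latticeTerm, eval_add]
    ring
  map_smul' b p := by
    rw [RingHom.id_apply, smul_eq_mul, ← tsum_mul_left]
    refine tsum_congr fun k => ?_
    simp only [latticeTerm, eval_smul, smul_eq_mul]
    ring

end LatticeSums

section Uniqueness

lemma natDegree_sub_C_mul_lt {m : ℕ} {r p : ℝ[X]} (hr : r.natDegree = m) (hr0 : r ≠ 0)
    (hp : p.Monic) (hpd : p.natDegree = m) :
    r - C r.leadingCoeff * p = 0 ∨ (r - C r.leadingCoeff * p).natDegree < m := by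
  by_cases h : r - C r.leadingCoeff * p = 0
  · exact Or.inl h
  · right
    have hl : r.leadingCoeff ≠ 0 := leadingCoeff_ne_zero.2 hr0
    have hlt : (r - C r.leadingCoeff * p).degree < r.degree := by
      refine degree_sub_lt_left ?_ hr0 ?_
      · rw [degree_C_mul hl, degree_eq_natDegree hr0, degree_eq_natDegree hp.ne_zero, hr, hpd]
      · simp [hp.leadingCoeff]
    exact hr ▸ natDegree_lt_natDegree h hlt

lemma map_mul_eq_zero_of_natDegree_lt (L : ℝ[X] →ₗ[ℝ] ℝ) {P : ℕ → ℝ[X]}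
    (hm : ∀ n, (P n).Monic) (hd : ∀ n, (P n).natDegree = n)
    (ho : ∀ n m, n ≠ m → L (P n * P m) = 0) (n : ℕ) (r : ℝ[X]) (hr : r.natDegree < n) :
    L (P n * r) = 0 := by
  induction hk : r.natDegree using Nat.strong_induction_on generalizing r with
  | _ k ih =>
    by_cases hr0 : r = 0
    · simp [hr0]
    have hsplit : P n * r
        = r.leadingCoeff • (P n * P k) + P n * (r - C r.leadingCoeff * P k) := by
      rw [smul_eq_C_mul]
      ring
    rw [hsplit, map_add, map_smul, ho n k (by omega), smul_zero, zero_add]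
    rcases natDegree_sub_C_mul_lt hk hr0 (hm k) (hd k) with h | h
    · simp [h]
    · exact ih _ h _ (by omega) rfl

/-- Monic orthogonal polynomials for a linear functional are unique. -/
lemma monic_orthogonal_unique (L : ℝ[X] →ₗ[ℝ] ℝ) {P Q : ℕ → ℝ[X]}
    (hPm : ∀ n, (P n).Monic) (hPd : ∀ n, (P n).natDegree = n)
    (hPo : ∀ n m, n ≠ m → L (P n * P m) = 0) (hP0 : ∀ n, L (P n * P n) ≠ 0)
    (hQm : ∀ n, (Q n).Monic) (hQd : ∀ n, (Q n).natDegree = n)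
    (hQo : ∀ n m, n ≠ m → L (Q n * Q m) = 0) (n : ℕ) : P n = Q n := by
  by_contra hne
  set D := P n - Q n with hD
  have hD0 : D ≠ 0 := sub_ne_zero.2 hne
  have hlt : D.natDegree < n := by
    have h := degree_sub_lt_left (p := P n) (q := Q n)
      (by rw [degree_eq_natDegree (hPm n).ne_zero, degree_eq_natDegree (hQm n).ne_zero, hPd, hQd])
      (hPm n).ne_zero (by rw [(hPm n).leadingCoeff, (hQm n).leadingCoeff])
    exact hPd n ▸ natDegree_lt_natDegree hD0 h
  set m := D.natDegree with hmdef
  have h1 : L (P m * D) = 0 := by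
    rw [mul_comm, hD, sub_mul, map_sub,
      map_mul_eq_zero_of_natDegree_lt L hPm hPd hPo n _ (by rwa [hPd]),
      map_mul_eq_zero_of_natDegree_lt L hQm hQd hQo n _ (by rwa [hPd]), sub_zero]
  have h2 : L (P m * (D - C D.leadingCoeff * P m)) = 0 := by
    rcases natDegree_sub_C_mul_lt hmdef.symm hD0 (hPm m) (hPd m) with h | h
    · simp [h]
    · exact map_mul_eq_zero_of_natDegree_lt L hPm hPd hPo m _ h
  have hsplit : P m * D
      = D.leadingCoeff • (P m * P m) + P m * (D - C D.leadingCoeff * P m) := by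
    rw [smul_eq_C_mul]
    ring
  rw [hsplit, map_add, h2, add_zero, map_smul, smul_eq_mul] at h1
  exact (mul_ne_zero (leadingCoeff_ne_zero.2 hD0) (hP0 m)) h1

end Uniqueness

lemma hqfun_mul_exp {q : ℝ} (hq0 : 0 < q) (hq1 : q < 1) {c : ℝ} (hc : 0 < c) :
    hqfun q ((c : ℝ) * Complex.exp ((Real.pi / 4 : ℝ) * Complex.I))
      = -2 * Complex.exp ((Real.pi / 4 : ℝ) * Complex.I)
        * (Complex.I * kernelSum q 3 c + kernelSum q 1 c) := by
  set e := Complex.exp ((Real.pi / 4 : ℝ) * Complex.I) with he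
  have he2 : e ^ 2 = Complex.I := by
    rw [he, ← Complex.exp_nat_mul]
    refine (congrArg Complex.exp ?_).trans Complex.exp_pi_div_two_mul_I
    push_cast
    ring
  have hc' : 0 < c⁻¹ := inv_pos.2 hc
  rw [← kernelSum_one_inv hq0 hc, ← kernelSum_three_inv hq0 hc]
  have h1 := Complex.hasSum_ofReal.2
    (summable_kernel hq0 hq1 (a := 1) le_rfl (by norm_num) hc').hasSum
  have h3 := Complex.hasSum_ofReal.2
    (summable_kernel hq0 hq1 (a := 3) (by norm_num) le_rfl hc').hasSum
  refine (((h1.mul_left Complex.I).add h3).mul_left (-2 * e)).tsum_eq ▸ tsum_congr fun k => ?_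
  have hx : 0 < q ^ k := by positivity
  have hz : (q : ℂ) ^ (2 * k) = ((q ^ k : ℝ) : ℂ) ^ 2 := by
    rw [mul_comm, zpow_mul]
    push_cast
    norm_cast
  rw [hz, ← Complex.ofReal_zpow, mul_pow, he2]
  set x := q ^ k
  have hne : (c : ℂ) ^ 2 * Complex.I - (x : ℂ) ^ 2 ≠ 0 := by
    intro h
    have := congrArg Complex.im h
    simp [← Complex.ofReal_pow, hc.ne'] at this
  have hne2 : (c : ℂ) ^ 4 + (x : ℂ) ^ 4 ≠ 0 := by
    have : c ^ 4 + x ^ 4 ≠ 0 := by positivity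
    exact_mod_cast this
  have hc0 : (c : ℂ) ≠ 0 := by exact_mod_cast hc.ne'
  have hI := Complex.I_sq
  have hden : (1 : ℂ) + ((c : ℂ)⁻¹ * x) ^ 4 = ((c : ℂ) ^ 4 + (x : ℂ) ^ 4) / (c : ℂ) ^ 4 := by
    field_simp
  push_cast
  rw [hden, div_eq_iff hne]
  field_simp
  linear_combination (e * x * (c : ℂ) ^ 4) * hI

theorem statement17 (q : ℝ) (hq0 : 0 < q) (hq1 : q < 1)
    (F : MonicOrthFamily q 1) (G : MonicOrthFamily q (Real.sqrt q)) :
    (∀ n : ℕ, F.P n = G.P n) ∧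
    (F.γ 1 : ℂ) / (G.γ 1 : ℂ)
      = (Real.sqrt q : ℂ) * hqfun q (Complex.exp ((Real.pi / 4 : ℝ) * Complex.I))
          / hqfun q ((Real.sqrt q : ℝ) * Complex.exp ((Real.pi / 4 : ℝ) * Complex.I)) := by
  have hs : 0 < √q := Real.sqrt_pos.2 hq0
  have hS1 : 0 < kernelSum q 1 1 := kernelSum_pos hq0 hq1 le_rfl (by norm_num) one_pos
  have hS2 : 0 < kernelSum q 1 (√q) := kernelSum_pos hq0 hq1 le_rfl (by norm_num) hs
  have hE1 := kernelSum_three_one hq0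
  have hE2 := kernelSum_three_sqrt hq0
  choose K hK using exists_hasSum_latticeTerm hq0 hq1
  have hFK : ∀ n m, K (F.P n * F.P m) * kernelSum q 1 1 = if n = m then F.γ n else 0 := by
    intro n m
    rw [← F.orth n m, ← div_one (kernelSum q 1 1), ← (hK _ 1 one_pos hE1).tsum_eq]
    simp only [latticeTerm, eval_mul]
  have hGK : ∀ n m, K (G.P n * G.P m) * (kernelSum q 1 (√q) / √q)
      = if n = m then G.γ n else 0 := by
    intro n m
    rw [← G.orth n m, ← (hK _ _ hs hE2).tsum_eq]
    simp only [latticeTerm, eval_mul]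
  set L := latticeFunctional q 1 fun p => (hK p 1 one_pos hE1).summable
  have hL : ∀ p, L p = K p * kernelSum q 1 1 := fun p => by
    rw [← div_one (kernelSum q 1 1)]
    exact (hK p 1 one_pos hE1).tsum_eq
  have hPQ : ∀ n, F.P n = G.P n := by
    refine monic_orthogonal_unique L F.monic F.deg (fun n m h => ?_) (fun n => ?_)
      G.monic G.deg fun n m h => ?_
    · rw [hL, hFK, if_neg h]
    · rw [hL, hFK, if_pos rfl]
      exact (F.γ_pos n).ne'
    · have h0 := hGK n m
      rw [if_neg h, mul_eq_zero, or_iff_left (by positivity)] at h0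
      rw [hL, h0, zero_mul]
  refine ⟨hPQ, ?_⟩
  have hF1 := hFK 1 1
  have hG1 := hGK 1 1
  rw [if_pos rfl] at hF1 hG1
  rw [hPQ] at hF1
  have hKne : K (G.P 1 * G.P 1) ≠ 0 := by
    intro h
    rw [h, zero_mul] at hG1
    exact (G.γ_pos 1).ne hG1
  have h1 := hqfun_mul_exp hq0 hq1 one_pos
  rw [Complex.ofReal_one, one_mul] at h1
  rw [h1, hqfun_mul_exp hq0 hq1 hs, hE1, hE2, ← hF1, ← hG1]
  have hI : Complex.I + 1 ≠ 0 := by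
    intro h
    simpa using congrArg Complex.re h
  have hS1' : (kernelSum q 1 1 : ℂ) ≠ 0 := by exact_mod_cast hS1.ne'
  have hS2' : (kernelSum q 1 (√q) : ℂ) ≠ 0 := by exact_mod_cast hS2.ne'
  have hs' : (√q : ℂ) ≠ 0 := by exact_mod_cast hs.ne'
  have hK' : (K (G.P 1 * G.P 1) : ℂ) ≠ 0 := by exact_mod_cast hKne
  have he := Complex.exp_ne_zero ((Real.pi / 4 : ℝ) * Complex.I)
  have hfac : ∀ s : ℂ, Complex.I * s + s = (Complex.I + 1) * s := fun s => by ring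
  rw [hfac, hfac]
  push_cast at he ⊢
  field_simp
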